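/- arXiv:2603.05739 — 2 statements merged into one kernel-verified Lean document; each statement's English description precedes it below -/
import Mathlib

section
/- There is a universal constant C > 0 with the following property. Let Y be a measurable space, π_ref and q probability measures on Y with q ≪ π_ref and dq/dπ_ref ≤ L π_ref-almost everywhere for some L ≥ 1. Let r⋆, r̂ : Y → ℝ be measurable reward functions, π⋆ a probability measure with π⋆ ≪ π_ref, and N ≥ 1 an integer. Write ε = ε_pw(r̂) and assume 0 < ε ≤ e^{−1}. Then the Best-of-N policy π_BoN satisfies R_q^{r⋆}(π⋆) − R_q^{r⋆}(π_BoN) ≤ C·( L·N·ε·log(1/ε) + E_{N/log(1/ε)}(π⋆ ‖ π_ref) ). -/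
open MeasureTheory ENNReal

noncomputable section

section Defs

variable {Y : Type*} [MeasurableSpace Y]

/-- Pairwise comparison outcome `φ_r(y,y')`. -/
def phi (r : Y → ℝ) (y y' : Y) : ℝ :=
  (if r y' < r y then 1 else 0) + (1 / 2) * (if r y = r y' then 1 else 0)

/-- Win-rate of `π` against comparison measure `q` under reward `r`. -/
def winRateQ (q : Measure Y) (r : Y → ℝ) (π : Measure Y) : ℝ :=
  ∫ y, ∫ y', phi r y y' ∂q ∂π

/-- Win-rate of `π` against `πref` under reward `r`. -/
def winRate (πref : Measure Y) (r : Y → ℝ) (π : Measure Y) : ℝ :=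
  winRateQ πref r π

/-- Pairwise win-rate error of `rhat` w.r.t. true reward `rstar` under `πref`. -/
def epw (πref : Measure Y) (rhat rstar : Y → ℝ) : ℝ :=
  ∫ y, ∫ y', |phi rhat y y' - phi rstar y y'| ∂πref ∂πref

/-- `E_M` divergence. -/
def EMdiv (M : ℝ) (ν μ : Measure Y) : ℝ :=
  ∫ y, max ((ν.rnDeriv μ y).toReal - M) 0 ∂μ

/-- Best-of-N selection map: returns `ys i` for the least index `i` attaining the
maximum of `rhat` over the batch. -/
def bonSelect (rhat : Y → ℝ) (N : ℕ) (hN : 0 < N) (ys : Fin N → Y) : Y :=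
  ys ((Finset.univ.filter fun i => ∀ j, rhat (ys j) ≤ rhat (ys i)).min'
    (by
      obtain ⟨i, -, hi⟩ :=
        Finset.exists_max_image (Finset.univ : Finset (Fin N)) (fun i => rhat (ys i))
          ⟨⟨0, hN⟩, Finset.mem_univ _⟩
      exact ⟨i, Finset.mem_filter.mpr ⟨Finset.mem_univ _, fun j => hi j (Finset.mem_univ _)⟩⟩))

/-- The Best-of-N policy: pushforward of `πref^{⊗N}` under the selection map. -/
def bonPolicy (πref : Measure Y) (rhat : Y → ℝ) (N : ℕ) (hN : 0 < N) : Measure Y :=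
  Measure.map (bonSelect rhat N hN) (Measure.pi fun _ : Fin N => πref)

/-- Uniform distribution on `[0,1]`. -/
def unif01 : Measure ℝ := (volume : Measure ℝ).restrict (Set.Icc 0 1)

/-- Indices whose tie-broken pair `(rhat (ys i'), vs i')` is lexicographically strictly
above that of `i` (final ties broken by index). -/
def lexAbove (rhat : Y → ℝ) {N : ℕ} (ys : Fin N → Y) (vs : Fin N → ℝ) (i : Fin N) :
    Finset (Fin N) :=
  Finset.univ.filter fun i' =>
    rhat (ys i) < rhat (ys i') ∨
      (rhat (ys i) = rhat (ys i') ∧ (vs i < vs i' ∨ (vs i = vs i' ∧ i' < i)))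

/-- The empirical `E_M`-regularized Best-of-N policy: draw `N` i.i.d. samples from `πref`
and independent uniform tie-breakers, and output a uniformly random element among the
top-`k` samples in the lexicographic order on `(rhat (y i), V i)`. -/
def empPolicy (πref : Measure Y) (rhat : Y → ℝ) (N k : ℕ) : Measure Y :=
  (k : ℝ≥0∞)⁻¹ • ∑ i : Fin N,
    Measure.map (fun ω : (Fin N → Y) × (Fin N → ℝ) => ω.1 i)
      (((Measure.pi fun _ : Fin N => πref).prod (Measure.pi fun _ : Fin N => unif01)).restrict
        {ω : (Fin N → Y) × (Fin N → ℝ) | (lexAbove rhat ω.1 ω.2 i).card < k})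

/-- Total variation distance. -/
def TV (μ ν : Measure Y) : ℝ :=
  ⨆ A : {A : Set Y // MeasurableSet A}, |(μ A.1).toReal - (ν A.1).toReal|

end Defs


section Helpers

variable {Y : Type*} [MeasurableSpace Y]

theorem bonSelect_spec (rhat : Y → ℝ) (N : ℕ) (hN : 0 < N) (ys : Fin N → Y) :
    ∃ i, bonSelect rhat N hN ys = ys i ∧ (∀ j, rhat (ys j) ≤ rhat (ys i)) ∧
      ∀ k, k < i → ¬ (∀ j, rhat (ys j) ≤ rhat (ys k)) := by
  unfold bonSelect
  generalize_proofs h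
  refine ⟨_, rfl, ?_, ?_⟩
  · exact (Finset.mem_filter.mp (Finset.min'_mem _ h)).2
  · intro k hk hk2
    exact absurd (Finset.min'_le _ k (Finset.mem_filter.mpr ⟨Finset.mem_univ _, hk2⟩))
      (not_le.mpr hk)

theorem bonSelect_mem_iff (rhat : Y → ℝ) (N : ℕ) (hN : 0 < N) (ys : Fin N → Y) (A : Set Y) :
    bonSelect rhat N hN ys ∈ A ↔ ∃ i, ys i ∈ A ∧ (∀ j, rhat (ys j) ≤ rhat (ys i)) ∧
      ∀ k, k < i → ¬ (∀ j, rhat (ys j) ≤ rhat (ys k)) := by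
  obtain ⟨i, h1, h2, h3⟩ := bonSelect_spec rhat N hN ys
  constructor
  · intro h
    exact ⟨i, h1 ▸ h, h2, h3⟩
  · rintro ⟨k, hk, hk2, hk3⟩
    have : i = k := by
      rcases lt_trichotomy i k with h | h | h
      · exact absurd h2 (hk3 i h)
      · exact h
      · exact absurd hk2 (h3 k h)
    rw [h1, this]; exact hk

theorem measurable_bonSelect (rhat : Y → ℝ) (hr : Measurable rhat) (N : ℕ) (hN : 0 < N) :
    Measurable (bonSelect rhat N hN) := by
  intro A hA
  have hm : ∀ i : Fin N, MeasurableSet {ys : Fin N → Y | ∀ j, rhat (ys j) ≤ rhat (ys i)} := by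
    intro i
    rw [Set.setOf_forall]
    refine MeasurableSet.iInter fun j => ?_
    exact measurableSet_le (hr.comp (measurable_pi_apply j)) (hr.comp (measurable_pi_apply i))
  have : bonSelect rhat N hN ⁻¹' A = ⋃ i : Fin N, ((fun ys : Fin N → Y => ys i) ⁻¹' A) ∩
      ({ys : Fin N → Y | ∀ j, rhat (ys j) ≤ rhat (ys i)} ∩
      ⋂ k : Fin N, ⋂ _ : k < i, {ys : Fin N → Y | ∀ j, rhat (ys j) ≤ rhat (ys k)}ᶜ) := by
    ext ys
    simp only [Set.mem_preimage, bonSelect_mem_iff, Set.mem_iUnion, Set.mem_inter_iff,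
      Set.mem_iInter, Set.mem_compl_iff, Set.mem_setOf_eq]
  rw [this]
  refine MeasurableSet.iUnion fun i => (measurable_pi_apply i hA).inter ((hm i).inter ?_)
  exact MeasurableSet.iInter fun k => MeasurableSet.iInter fun _ => (hm k).compl

theorem isProb_bon (μ : Measure Y) [IsProbabilityMeasure μ] (rhat : Y → ℝ) (hr : Measurable rhat)
    (N : ℕ) (hN : 0 < N) : IsProbabilityMeasure (bonPolicy μ rhat N hN) :=
  Measure.isProbabilityMeasure_map (measurable_bonSelect rhat hr N hN).aemeasurable

theorem bon_le (μ : Measure Y) [IsProbabilityMeasure μ] (rhat : Y → ℝ) (hr : Measurable rhat)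
    (N : ℕ) (hN : 0 < N) : bonPolicy μ rhat N hN ≤ (N : ℝ≥0∞) • μ := by
  rw [Measure.le_iff]
  intro A hA
  rw [bonPolicy, Measure.map_apply (measurable_bonSelect rhat hr N hN) hA]
  calc _ ≤ (Measure.pi fun _ : Fin N => μ) (⋃ i : Fin N, ((fun ys : Fin N → Y => ys i) ⁻¹' A)) := by
        apply measure_mono
        intro ys hys
        obtain ⟨i, h1, -⟩ := (bonSelect_mem_iff rhat N hN ys A).mp hys
        exact Set.mem_iUnion.mpr ⟨i, h1⟩
    _ ≤ ∑ i : Fin N, (Measure.pi fun _ : Fin N => μ) ((fun ys : Fin N → Y => ys i) ⁻¹' A) :=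
        measure_iUnion_fintype_le _ _
    _ = ∑ i : Fin N, μ A := by
        refine Finset.sum_congr rfl fun i _ => ?_
        exact (measurePreserving_eval (fun _ : Fin N => μ) i).measure_preimage hA.nullMeasurableSet
    _ = _ := by simp

theorem bon_upper (μ : Measure Y) [IsProbabilityMeasure μ] (rhat : Y → ℝ) (hr : Measurable rhat)
    (N : ℕ) (hN : 0 < N) (A : Set Y) (hA : MeasurableSet A)
    (hup : ∀ x y, rhat x ≤ rhat y → x ∈ A → y ∈ A) :
    (bonPolicy μ rhat N hN).real A = 1 - (1 - μ.real A) ^ N := by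
  have := isProb_bon μ rhat hr N hN
  have h1 : (bonPolicy μ rhat N hN) Aᶜ = (μ Aᶜ) ^ N := by
    rw [bonPolicy, Measure.map_apply (measurable_bonSelect rhat hr N hN) hA.compl]
    have : bonSelect rhat N hN ⁻¹' Aᶜ = Set.pi Set.univ (fun _ : Fin N => Aᶜ) := by
      ext ys
      obtain ⟨i, h1, h2, -⟩ := bonSelect_spec rhat N hN ys
      simp only [Set.mem_preimage, h1, Set.mem_pi, Set.mem_univ, true_imp_iff, Set.mem_compl_iff]
      exact ⟨fun h j hj => h (hup _ _ (h2 j) hj), fun h => h i⟩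
    rw [this, Measure.pi_pi]; simp
  have h2 : (bonPolicy μ rhat N hN).real Aᶜ = (μ.real Aᶜ) ^ N := by
    simp [Measure.real, h1, ENNReal.toReal_pow]
  rw [probReal_compl_eq_one_sub hA, probReal_compl_eq_one_sub hA] at h2
  linarith

theorem scalar_bound (N : ℕ) (hN : 0 < N) (a u m : ℝ) (ha : 0 < a) (hu0 : 0 ≤ u) (hu1 : u ≤ 1)
    (hm1 : m ≤ 1) (hm : m ≤ (N : ℝ) / a * u) :
    m ≤ 1 - (1 - u) ^ N + Real.exp (-a) := by
  have hpow : (1 - u) ^ N ≤ Real.exp (-((N : ℝ) * u)) := by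
    have : (1 - u) ^ N ≤ (Real.exp (-u)) ^ N :=
      pow_le_pow_left₀ (by linarith) (Real.one_sub_le_exp_neg u) N
    rwa [← Real.exp_nat_mul, mul_neg] at this
  set x := (N : ℝ) / a * u with hx
  have hNu : (N : ℝ) * u = a * x := by rw [hx]; field_simp
  have hx0 : 0 ≤ x := by positivity
  rw [hNu] at hpow
  have hea := Real.exp_pos (-a)
  by_cases h : 1 ≤ x
  · have : Real.exp (-(a * x)) ≤ Real.exp (-a) := Real.exp_le_exp.mpr (by nlinarith)
    linarith
  · push Not at h
    have hc := convexOn_exp.2 (Set.mem_univ (0 : ℝ)) (Set.mem_univ (-a))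
      (by linarith : 0 ≤ 1 - x) hx0 (by ring)
    simp only [smul_eq_mul, mul_zero, zero_add, Real.exp_zero, mul_one] at hc
    have : x * -a = -(a * x) := by ring
    rw [this] at hc
    nlinarith

theorem phi_nonneg (r : Y → ℝ) (y y' : Y) : 0 ≤ phi r y y' := by
  unfold phi; split_ifs <;> norm_num

theorem phi_le_one (r : Y → ℝ) (y y' : Y) : phi r y y' ≤ 1 := by
  unfold phi; split_ifs <;> first | linarith | norm_num

theorem measurable_phi (r : Y → ℝ) (hr : Measurable r) :
    Measurable (fun z : Y × Y => phi r z.1 z.2) := by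
  unfold phi
  refine Measurable.add ?_ (Measurable.const_mul ?_ _)
  · exact Measurable.ite (measurableSet_lt (hr.comp measurable_snd) (hr.comp measurable_fst))
      measurable_const measurable_const
  · exact Measurable.ite (measurableSet_eq_fun (hr.comp measurable_fst) (hr.comp measurable_snd))
      measurable_const measurable_const

theorem integrable_of_bdd (μ : Measure Y) [IsFiniteMeasure μ] (f : Y → ℝ) (hf : Measurable f)
    (h0 : ∀ y, 0 ≤ f y) (h1 : ∀ y, f y ≤ 1) : Integrable f μ :=
  Integrable.of_bound hf.aestronglyMeasurable 1
    (Filter.Eventually.of_forall fun y => by rw [Real.norm_eq_abs, abs_of_nonneg (h0 y)]; exact h1 y)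

theorem fixed_bound (μ : Measure Y) [IsProbabilityMeasure μ] (π : Measure Y)
    [IsProbabilityMeasure π] (hπ : π ≪ μ) (rstar rhat : Y → ℝ) (hs : Measurable rstar)
    (hr : Measurable rhat) (N : ℕ) (hN : 0 < N) (a : ℝ) (ha : 0 < a) (y' : Y) :
    ∫ y, phi rstar y y' ∂π - ∫ y, phi rstar y y' ∂(bonPolicy μ rhat N hN) ≤
      EMdiv ((N : ℝ) / a) π μ + Real.exp (-a) +
        ((N : ℝ) / a + N) * ∫ y, |phi rhat y y' - phi rstar y y'| ∂μ := by
  have hB := isProb_bon μ rhat hr N hN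
  have hBle := bon_le μ rhat hr N hN
  set B := bonPolicy μ rhat N hN with hBdef
  set M := (N : ℝ) / a with hM
  have hM0 : 0 ≤ M := by positivity
  set p : Y → ℝ := fun y => (π.rnDeriv μ y).toReal with hp
  have hpm : Measurable p := (Measure.measurable_rnDeriv π μ).ennreal_toReal
  have hp0 : ∀ y, 0 ≤ p y := fun y => ENNReal.toReal_nonneg
  have hpi : Integrable p μ := Measure.integrable_toReal_rnDeriv
  have hpint : ∫ y, p y ∂μ = 1 := by
    rw [Measure.integral_toReal_rnDeriv hπ]; simp
  have hms : Measurable (fun y => phi rstar y y') :=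
    (measurable_phi rstar hs).comp (measurable_id.prodMk measurable_const)
  have hmh : Measurable (fun y => phi rhat y y') :=
    (measurable_phi rhat hr).comp (measurable_id.prodMk measurable_const)
  have his : ∀ (ν : Measure Y) [IsFiniteMeasure ν], Integrable (fun y => phi rstar y y') ν :=
    fun ν _ => integrable_of_bdd ν _ hms (fun y => phi_nonneg _ _ _) (fun y => phi_le_one _ _ _)
  have hih : ∀ (ν : Measure Y) [IsFiniteMeasure ν], Integrable (fun y => phi rhat y y') ν :=
    fun ν _ => integrable_of_bdd ν _ hmh (fun y => phi_nonneg _ _ _) (fun y => phi_le_one _ _ _)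
  have hid : ∀ (ν : Measure Y) [IsFiniteMeasure ν],
      Integrable (fun y => |phi rhat y y' - phi rstar y y'|) ν :=
    fun ν _ => ((hih ν).sub (his ν)).abs
  have hmin : Integrable (fun y => min (p y) M) μ := hpi.inf (integrable_const M)
  have hmin0 : ∀ y, 0 ≤ min (p y) M := fun y => le_min (hp0 y) hM0
  -- key set bound
  have key : ∀ A : Set Y, MeasurableSet A → (∀ x y, rhat x ≤ rhat y → x ∈ A → y ∈ A) →
      ∫ y in A, min (p y) M ∂μ ≤ B.real A + Real.exp (-a) := by
    intro A hA hup
    rw [hBdef, bon_upper μ rhat hr N hN A hA hup]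
    refine scalar_bound N hN a (μ.real A) _ ha measureReal_nonneg measureReal_le_one ?_ ?_
    · calc _ ≤ ∫ y, min (p y) M ∂μ :=
            setIntegral_le_integral hmin (Filter.Eventually.of_forall hmin0)
        _ ≤ ∫ y, p y ∂μ := integral_mono hmin hpi fun y => min_le_left _ _
        _ = 1 := hpint
    · calc _ ≤ ∫ y in A, M ∂μ :=
            integral_mono hmin.integrableOn (integrable_const M) fun y => min_le_right _ _
        _ = _ := by rw [setIntegral_const, smul_eq_mul, mul_comm]
  set A1 : Set Y := {y | rhat y' < rhat y} with hA1
  set A2 : Set Y := {y | rhat y' ≤ rhat y} with hA2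
  have hA1m : MeasurableSet A1 := measurableSet_lt measurable_const hr
  have hA2m : MeasurableSet A2 := measurableSet_le measurable_const hr
  have k1 := key A1 hA1m (fun x y h hx => lt_of_lt_of_le hx h)
  have k2 := key A2 hA2m (fun x y h hx => le_trans hx h)
  have hphi : ∀ y, phi rhat y y' =
      (1/2) * A1.indicator (fun _ => (1:ℝ)) y + (1/2) * A2.indicator (fun _ => (1:ℝ)) y := by
    intro y
    simp only [phi, Set.indicator, hA1, hA2, Set.mem_setOf_eq]
    rcases lt_trichotomy (rhat y) (rhat y') with h | h | h
    · simp [h.not_gt, h.ne, h.not_ge]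
    · simp [h]
    · simp [h, h.ne', h.le]; norm_num
  have e1 : ∫ y, phi rhat y y' ∂B = (1/2) * B.real A1 + (1/2) * B.real A2 := by
    simp_rw [hphi]
    rw [integral_add, integral_const_mul, integral_const_mul, integral_indicator hA1m,
      integral_indicator hA2m]
    · simp
    · exact ((integrable_const (1:ℝ)).indicator hA1m).const_mul _
    · exact ((integrable_const (1:ℝ)).indicator hA2m).const_mul _
  have e2 : ∫ y, min (p y) M * phi rhat y y' ∂μ =
      (1/2) * ∫ y in A1, min (p y) M ∂μ + (1/2) * ∫ y in A2, min (p y) M ∂μ := by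
    rw [← integral_indicator hA1m, ← integral_indicator hA2m, ← integral_const_mul,
      ← integral_const_mul, ← integral_add]
    · congr 1; ext y; rw [hphi]; simp only [Set.indicator]; split_ifs <;> ring
    · exact (hmin.indicator hA1m).const_mul _
    · exact (hmin.indicator hA2m).const_mul _
  have e3 : ∫ y, min (p y) M * phi rhat y y' ∂μ ≤ ∫ y, phi rhat y y' ∂B + Real.exp (-a) := by
    rw [e1, e2]; linarith
  have hminphi : Integrable (fun y => min (p y) M * phi rhat y y') μ := by
    refine hmin.mul_bdd (c := 1) hmh.aestronglyMeasurable (Filter.Eventually.of_forall fun y => ?_)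
    rw [Real.norm_eq_abs, abs_of_nonneg (phi_nonneg _ _ _)]; exact phi_le_one _ _ _
  have hpphi : Integrable (fun y => p y * phi rstar y y') μ := by
    refine hpi.mul_bdd (c := 1) hms.aestronglyMeasurable (Filter.Eventually.of_forall fun y => ?_)
    rw [Real.norm_eq_abs, abs_of_nonneg (phi_nonneg _ _ _)]; exact phi_le_one _ _ _
  have hmax : Integrable (fun y => max (p y - M) 0) μ :=
    (hpi.sub (integrable_const M)).sup (integrable_const 0)
  have hsum : Integrable (fun y => max (p y - M) 0 + min (p y) M * phi rhat y y') μ :=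
    hmax.add hminphi
  have e4 : ∫ y, phi rstar y y' ∂π ≤ EMdiv M π μ + ∫ y, min (p y) M * phi rhat y y' ∂μ
      + M * ∫ y, |phi rhat y y' - phi rstar y y'| ∂μ := by
    rw [← integral_rnDeriv_smul hπ]
    unfold EMdiv
    rw [← integral_const_mul, ← integral_add hmax hminphi,
      ← integral_add hsum ((hid μ).const_mul M)]
    refine integral_mono hpphi (hsum.add ((hid μ).const_mul M)) fun y => ?_
    simp only [smul_eq_mul, Pi.add_apply]
    change p y * phi rstar y y' ≤ max (p y - M) 0 + min (p y) M * phi rhat y y'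
      + M * |phi rhat y y' - phi rstar y y'|
    have h1 : p y = max (p y - M) 0 + min (p y) M := by
      rcases le_total (p y) M with h | h
      · rw [max_eq_right (by linarith), min_eq_left h]; ring
      · rw [max_eq_left (by linarith), min_eq_right h]; ring
    have h2 := neg_abs_le (phi rhat y y' - phi rstar y y')
    have h3 := abs_nonneg (phi rhat y y' - phi rstar y y')
    have h4 : 0 ≤ max (p y - M) 0 := le_max_right _ _
    have h5 := hmin0 y
    have h6 : min (p y) M ≤ M := min_le_right _ _
    have h7 := phi_le_one rstar y y'
    calc p y * phi rstar y y' = max (p y - M) 0 * phi rstar y y'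
          + min (p y) M * phi rstar y y' := by rw [← add_mul, ← h1]
      _ ≤ _ := by nlinarith [mul_le_mul_of_nonneg_left h7 h4, mul_le_mul_of_nonneg_right h6 h3]
  have e5 : ∫ y, phi rhat y y' ∂B ≤ ∫ y, phi rstar y y' ∂B
      + N * ∫ y, |phi rhat y y' - phi rstar y y'| ∂μ := by
    have h1 : ∫ y, |phi rhat y y' - phi rstar y y'| ∂B ≤
        N * ∫ y, |phi rhat y y' - phi rstar y y'| ∂μ := by
      have := integral_mono_measure hBle
        (Filter.Eventually.of_forall fun y => abs_nonneg (phi rhat y y' - phi rstar y y'))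
        ((hid μ).smul_measure (ENNReal.natCast_ne_top N))
      rwa [integral_smul_measure, ENNReal.toReal_natCast, smul_eq_mul] at this
    have h2 : ∫ y, phi rhat y y' ∂B ≤ ∫ y, (phi rstar y y' + |phi rhat y y' - phi rstar y y'|) ∂B :=
      integral_mono (hih B) ((his B).add (hid B)) fun y => by
        have := le_abs_self (phi rhat y y' - phi rstar y y')
        simp only; linarith
    rw [integral_add (his B) (hid B)] at h2
    linarith
  linarith

end Helpers

/-- **Best-of-N win-rate regret upper bound against an arbitrary comparison measure `q`.**
There is a universal constant `C > 0` such that if `q ≪ πref` with density ratio bounded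
by `L ≥ 1` `πref`-a.e., then for measurable rewards `r⋆, r̂`, comparator `π⋆ ≪ πref`,
`N ≥ 1`, and `ε = ε_pw(r̂)` with `0 < ε ≤ e⁻¹`, the Best-of-N policy satisfies
`R_q^{r⋆}(π⋆) − R_q^{r⋆}(π_BoN) ≤ C (L N ε log(1/ε) + E_{N/log(1/ε)}(π⋆ ‖ πref))`. -/
theorem stmt_6 :
    ∃ C : ℝ, 0 < C ∧
      ∀ (Y : Type) [MeasurableSpace Y]
        (πref q : Measure Y) [IsProbabilityMeasure πref] [IsProbabilityMeasure q],
        q ≪ πref →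
        ∀ (L : ℝ), 1 ≤ L → (∀ᵐ y ∂πref, (q.rnDeriv πref y).toReal ≤ L) →
        ∀ (rstar rhat : Y → ℝ), Measurable rstar → Measurable rhat →
        ∀ (πstar : Measure Y) [IsProbabilityMeasure πstar], πstar ≪ πref →
        ∀ (N : ℕ) (hN : 0 < N) (ε : ℝ), ε = epw πref rhat rstar →
          0 < ε → ε ≤ Real.exp (-1) →
          winRateQ q rstar πstar - winRateQ q rstar (bonPolicy πref rhat N hN) ≤
            C * (L * (N : ℝ) * ε * Real.log (1 / ε) +
              EMdiv ((N : ℝ) / Real.log (1 / ε)) πstar πref) := by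
  refine ⟨3, by norm_num, ?_⟩
  intro Y _ μ q _ _ hq L hL hqL rstar rhat hs hr π _ hπ N hN ε hε hε0 hε1
  have hB := isProb_bon μ rhat hr N hN
  set a := Real.log (1 / ε) with ha
  have ha' : a = - Real.log ε := by rw [ha, one_div, Real.log_inv]
  have ha1 : 1 ≤ a := by
    have := Real.log_le_log hε0 hε1
    rw [Real.log_exp] at this; linarith
  have hea : Real.exp (-a) = ε := by rw [ha', neg_neg, Real.exp_log hε0]
  have hdm : Measurable (fun z : Y × Y => |phi rhat z.1 z.2 - phi rstar z.1 z.2|) :=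
    continuous_abs.measurable.comp ((measurable_phi rhat hr).sub (measurable_phi rstar hs))
  have hd1 : ∀ y y', |phi rhat y y' - phi rstar y y'| ≤ 1 := fun y y' => abs_le.mpr
    ⟨by linarith [phi_nonneg rhat y y', phi_le_one rstar y y'],
     by linarith [phi_nonneg rstar y y', phi_le_one rhat y y']⟩
  have swap : ∀ (f : Y × Y → ℝ) (_ : Measurable f) (_ : ∀ z, 0 ≤ f z) (_ : ∀ z, f z ≤ 1)
      (α β : Measure Y) [IsProbabilityMeasure α] [IsProbabilityMeasure β],
      ∫ y, ∫ y', f (y, y') ∂β ∂α = ∫ y', ∫ y, f (y, y') ∂α ∂β ∧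
      Integrable (fun y' => ∫ y, f (y, y') ∂α) β := by
    intro f hf h0 h1 α β _ _
    have hi := integrable_of_bdd (α.prod β) f hf h0 h1
    exact ⟨integral_integral_swap hi, hi.integral_prod_right⟩
  have sphi := swap (fun z => phi rstar z.1 z.2) (measurable_phi rstar hs)
    (fun z => phi_nonneg _ _ _) (fun z => phi_le_one _ _ _)
  have sd := swap _ hdm (fun z => abs_nonneg _) (fun z => hd1 _ _) μ
  simp only at sphi sd
  set D : Y → ℝ := fun y' => ∫ y, |phi rhat y y' - phi rstar y y'| ∂μ with hD
  have hDε : ∫ y', D y' ∂μ = ε := by rw [hε, epw, (sd μ).1]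
  have hD0 : ∀ y, 0 ≤ D y := fun y => integral_nonneg fun _ => abs_nonneg _
  have hDq : ∫ y', D y' ∂q ≤ L * ε := by
    rw [← integral_rnDeriv_smul hq, ← hDε, ← integral_const_mul]
    refine integral_mono_of_nonneg (Filter.Eventually.of_forall fun y => ?_)
      ((sd μ).2.const_mul L) ?_
    · exact mul_nonneg ENNReal.toReal_nonneg (hD0 y)
    · filter_upwards [hqL] with y hy
      exact mul_le_mul_of_nonneg_right hy (hD0 y)
  have main : winRateQ q rstar π - winRateQ q rstar (bonPolicy μ rhat N hN) ≤
      EMdiv ((N : ℝ) / a) π μ + ε + ((N : ℝ) / a + N) * ∫ y', D y' ∂q := by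
    unfold winRateQ
    rw [(sphi π q).1, (sphi _ q).1, ← integral_sub (sphi π q).2 (sphi _ q).2,
      ← integral_const_mul]
    have hc : ∫ _ : Y, (EMdiv ((N : ℝ) / a) π μ + ε) ∂q = EMdiv ((N : ℝ) / a) π μ + ε := by simp
    rw [← hc, ← integral_add (integrable_const _) ((sd q).2.const_mul _)]
    refine integral_mono ((sphi π q).2.sub (sphi _ q).2)
      ((integrable_const _).add ((sd q).2.const_mul _)) fun y' => ?_
    have := fixed_bound μ π hπ rstar rhat hs hr N hN a (by linarith) y'
    rw [hea] at this
    exact this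
  have hE0 : 0 ≤ EMdiv ((N : ℝ) / a) π μ := integral_nonneg fun y => le_max_right _ _
  have hN1 : (1 : ℝ) ≤ N := by exact_mod_cast hN
  have hMN : (N : ℝ) / a ≤ N := div_le_self (by linarith) ha1
  have hM0 : 0 ≤ (N : ℝ) / a := by positivity
  have h1 : ((N : ℝ) / a + N) * ∫ y', D y' ∂q ≤ (2 * N) * (L * ε) :=
    mul_le_mul (by linarith) hDq (integral_nonneg hD0) (by linarith)
  have h2 : ε ≤ L * N * ε := by
    have : 1 ≤ L * N := one_le_mul_of_one_le_of_one_le hL hN1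
    nlinarith
  have h3 : L * N * ε ≤ L * N * ε * a := le_mul_of_one_le_right (by positivity) ha1
  nlinarith
end
end

section
/- Let Y be a measurable space, π_ref a probability measure on Y, and r⋆, r̂ : Y → ℝ measurable reward functions. Then for every probability measure π on Y with π ≪ π_ref and every real M ≥ 1, |R^{r⋆}(π) − R^{r̂}(π)| ≤ M·ε_pw(r̂) + E_M(π ‖ π_ref). -/
open MeasureTheory ENNReal

noncomputable section

theorem phi_meas {Y : Type*} [MeasurableSpace Y] (r : Y → ℝ) (hr : Measurable r) :
    Measurable (fun p : Y × Y => phi r p.1 p.2) := by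
  unfold phi
  have h1 : Measurable fun p : Y × Y => r p.1 := hr.comp measurable_fst
  have h2 : Measurable fun p : Y × Y => r p.2 := hr.comp measurable_snd
  exact (Measurable.ite (measurableSet_lt h2 h1) measurable_const measurable_const).add
    ((Measurable.ite (measurableSet_eq_fun h1 h2) measurable_const measurable_const).const_mul _)

theorem phi_bd {Y : Type*} [MeasurableSpace Y] (r : Y → ℝ) (y y' : Y) :
    0 ≤ phi r y y' ∧ phi r y y' ≤ 1 := by
  unfold phi
  split_ifs with h1 h2
  · exact absurd h2 h1.ne'
  all_goals norm_num

theorem int_bd {X : Type*} [MeasurableSpace X] (μ : Measure X) [IsProbabilityMeasure μ]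
    (f : X → ℝ) (hf : StronglyMeasurable f) (h : ∀ x, 0 ≤ f x ∧ f x ≤ 1) :
    Integrable f μ ∧ 0 ≤ ∫ x, f x ∂μ ∧ ∫ x, f x ∂μ ≤ 1 := by
  have hi : Integrable f μ := Integrable.of_bound hf.aestronglyMeasurable 1
    (Filter.Eventually.of_forall fun x => by
      rw [Real.norm_eq_abs, abs_of_nonneg (h x).1]; exact (h x).2)
  refine ⟨hi, integral_nonneg fun x => (h x).1, ?_⟩
  calc ∫ x, f x ∂μ ≤ ∫ _, (1 : ℝ) ∂μ := integral_mono hi (integrable_const _) fun x => (h x).2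
    _ = 1 := by simp

/-- **Win-rate transfer lemma.** For any policy `π ≪ πref` and any `M ≥ 1`,
`|R^{r⋆}(π) − R^{r̂}(π)| ≤ M·ε_pw(r̂) + E_M(π ‖ πref)`. -/
theorem stmt_11 {Y : Type*} [MeasurableSpace Y]
    (πref : Measure Y) [IsProbabilityMeasure πref]
    (rstar rhat : Y → ℝ) (hrstar : Measurable rstar) (hrhat : Measurable rhat)
    (π : Measure Y) [IsProbabilityMeasure π] (hac : π ≪ πref)
    (M : ℝ) (hM : 1 ≤ M) :
    |winRate πref rstar π - winRate πref rhat π| ≤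
      M * epw πref rhat rstar + EMdiv M π πref := by
  have hms := phi_meas rstar hrstar
  have hmh := phi_meas rhat hrhat
  have hmd : Measurable (fun p : Y × Y => |phi rhat p.1 p.2 - phi rstar p.1 p.2|) :=
    (hmh.sub hms).abs
  have hbd : ∀ y y', 0 ≤ |phi rhat y y' - phi rstar y y'| ∧
      |phi rhat y y' - phi rstar y y'| ≤ 1 := fun y y' => by
    have h1 := phi_bd rhat y y'
    have h2 := phi_bd rstar y y'
    exact ⟨abs_nonneg _, abs_le.2 ⟨by linarith, by linarith⟩⟩
  have is := fun y => int_bd πref (fun y' => phi rstar y y')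
    (hms.comp measurable_prodMk_left).stronglyMeasurable (phi_bd rstar y)
  have ih := fun y => int_bd πref (fun y' => phi rhat y y')
    (hmh.comp measurable_prodMk_left).stronglyMeasurable (phi_bd rhat y)
  have id := fun y => int_bd πref (fun y' => |phi rhat y y' - phi rstar y y'|)
    (hmd.comp measurable_prodMk_left).stronglyMeasurable (hbd y)
  have ms : StronglyMeasurable fun y => ∫ y', phi rstar y y' ∂πref :=
    hms.stronglyMeasurable.integral_prod_right
  have mh : StronglyMeasurable fun y => ∫ y', phi rhat y y' ∂πref :=
    hmh.stronglyMeasurable.integral_prod_right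
  have md : StronglyMeasurable fun y => ∫ y', |phi rhat y y' - phi rstar y y'| ∂πref :=
    hmd.stronglyMeasurable.integral_prod_right
  have js := int_bd π _ ms fun y => (is y).2
  have jh := int_bd π _ mh fun y => (ih y).2
  have jd := int_bd π _ md fun y => (id y).2
  have kd := int_bd πref _ md fun y => (id y).2
  have hD : Integrable (fun y => (π.rnDeriv πref y).toReal) πref := Measure.integrable_toReal_rnDeriv
  have hE : Integrable (fun y => max ((π.rnDeriv πref y).toReal - M) 0) πref :=
    (hD.sub (integrable_const M)).pos_part
  unfold winRate winRateQ epw EMdiv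
  rw [← integral_sub js.1 jh.1]
  calc _ ≤ ∫ y, |∫ y', phi rstar y y' ∂πref - ∫ y', phi rhat y y' ∂πref| ∂π :=
        abs_integral_le_integral_abs
    _ ≤ ∫ y, ∫ y', |phi rhat y y' - phi rstar y y'| ∂πref ∂π := by
        refine integral_mono (js.1.sub jh.1).abs jd.1 fun y => ?_
        change |∫ y', phi rstar y y' ∂πref - ∫ y', phi rhat y y' ∂πref| ≤ _
        rw [abs_sub_comm, ← integral_sub (ih y).1 (is y).1]
        exact abs_integral_le_integral_abs
    _ = ∫ y, (π.rnDeriv πref y).toReal * ∫ y', |phi rhat y y' - phi rstar y y'| ∂πref ∂πref :=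
        (integral_rnDeriv_smul hac).symm
    _ ≤ ∫ y, (M * (∫ y', |phi rhat y y' - phi rstar y y'| ∂πref) +
          max ((π.rnDeriv πref y).toReal - M) 0) ∂πref := by
        refine integral_mono ((integrable_rnDeriv_smul_iff hac).2 jd.1)
          ((kd.1.const_mul M).add hE) fun y => ?_
        have h := (id y).2
        change (π.rnDeriv πref y).toReal * (∫ y', |phi rhat y y' - phi rstar y y'| ∂πref) ≤
          M * (∫ y', |phi rhat y y' - phi rstar y y'| ∂πref) +
          max ((π.rnDeriv πref y).toReal - M) 0
        generalize (∫ y', |phi rhat y y' - phi rstar y y'| ∂πref) = g at h ⊢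
        have h1 := le_max_left ((π.rnDeriv πref y).toReal - M) 0
        have h2 := le_max_right ((π.rnDeriv πref y).toReal - M) 0
        nlinarith [mul_le_mul_of_nonneg_right h1 h.1, mul_le_mul_of_nonneg_left h.2 h2]
    _ = _ := by
        rw [integral_add (kd.1.const_mul M) hE, integral_const_mul]
end
end
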